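/- For every integral weight μ ∈ P, every LS path π ∈ B(μ) and every i ∈ I: ε_i(π) = −m_i^π and φ_i(π) = H_i^π(1) − m_i^π, where ε_i(π) = max{n ≥ 0 : ẽ_i^nπ ≠ 0} and φ_i(π) = max{n ≥ 0 : f̃_i^nπ ≠ 0}. -/

import Mathlib

open scoped Classical
noncomputable section

namespace LSPaper

/-- The clamp of a real number to the interval `[0,1]`; paths `[0,1] → V` are
encoded as functions `ℝ → V` that factor through this clamp. -/
def clamp01 (t : ℝ) : ℝ := max 0 (min 1 t)

variable {V : Type*} [AddCommGroup V] [Module ℝ V]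

/-- The straight-line path `π_ν(t) = t ν` (clamped outside `[0,1]`). -/
def straight (ν : V) : ℝ → V := fun t => clamp01 t • ν

/-- The dilation `(mπ)(t) = m • π(t)`. -/
def dilate (m : ℕ) (f : ℝ → V) : ℝ → V := fun t => (m : ℝ) • f t

/-- The concatenation `π_1 * ⋯ * π_m` of a list of paths:
`(π_1 * ⋯ * π_m)(t) = Σ_{l<k} π_l(1) + π_k(mt - k + 1)` for
`(k-1)/m ≤ t ≤ k/m`. -/
def concatList (l : List (ℝ → V)) : ℝ → V := fun t =>
  let m := l.length
  let k : ℕ := max 1 (min m (⌈(m : ℝ) * t⌉.toNat))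
  (((l.take (k - 1)).map fun f => f 1).sum) +
    (l.getD (k - 1) 0) ((m : ℝ) * t - ((k : ℝ) - 1))

/-- Subdivision of a path into `m` pieces:
`π_k(t) = π(t/m + (k-1)/m) - π((k-1)/m)` (here `k` runs over `0, …, m-1`). -/
def subdiv (m : ℕ) (f : ℝ → V) : List (ℝ → V) :=
  List.ofFn fun k : Fin m => fun t : ℝ =>
    f ((clamp01 t + (k : ℝ)) / m) - f ((k : ℝ) / m)

/-- The map `Σ_m : B(μ) → B(μ)^{⊗m}` (tensor factors encoded as a list):
dilate by `m`, then subdivide into `m` pieces. -/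
def SigmaMap (m : ℕ) (f : ℝ → V) : List (ℝ → V) := subdiv m (dilate m f)

/-- The weight of a tensor product (encoded as a list of paths): the sum of
the weights of the factors. -/
def tensWt (l : List (ℝ → V)) : V := (l.map fun f => f 1).sum

/-- A symmetrizable generalized Cartan matrix together with a realization:
an integral weight lattice `P` inside a real vector space `V`, linearly
independent simple roots `α i ∈ P` and simple coroots (as linear functionals)
with `⟨α j, α i∨⟩ = a i j`, taking integer values on `P`. -/
structure KacMoodyData (I : Type*) (V : Type*) [Fintype I] [DecidableEq I]
    [AddCommGroup V] [Module ℝ V] where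
  a : I → I → ℤ
  d : I → ℤ
  P : AddSubgroup V
  α : I → V
  coroot : I → V →ₗ[ℝ] ℝ
  diag : ∀ i, a i i = 2
  offDiag : ∀ i j, i ≠ j → a i j ≤ 0
  zeroIff : ∀ i j, a i j = 0 ↔ a j i = 0
  dPos : ∀ i, 0 < d i
  symmetrizable : ∀ i j, d i * a i j = d j * a j i
  cartanPairing : ∀ i j, coroot i (α j) = (a i j : ℝ)
  rootsIndep : LinearIndependent ℝ α
  corootsIndep : LinearIndependent ℝ coroot
  rootMem : ∀ i, α i ∈ P
  pairingInt : ∀ i, ∀ v ∈ P, ∃ n : ℤ, coroot i v = (n : ℝ)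
  latticeFree : ∃ n : ℕ, Nonempty (P ≃+ (Fin n → ℤ))

namespace KacMoodyData

variable {I : Type*} [Fintype I] [DecidableEq I]
variable (K : KacMoodyData I V)

/-- The simple reflection `r_i(x) = x - ⟨x, α_i∨⟩ α_i` as a linear map. -/
def reflMap (i : I) : V →ₗ[ℝ] V := LinearMap.id - (K.coroot i).smulRight (K.α i)

lemma reflMap_invol (i : I) : Function.Involutive (K.reflMap i) := by
  intro x
  have h2 : K.coroot i (K.α i) = 2 := by
    have h := K.cartanPairing i i
    rw [K.diag i] at h
    simpa using h
  simp only [reflMap, LinearMap.sub_apply, LinearMap.id_apply, LinearMap.smulRight_apply,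
    map_sub, map_smul, smul_eq_mul, h2]
  module

/-- The simple reflection `r_i` as a linear automorphism of `V`. -/
def refl (i : I) : V ≃ₗ[ℝ] V :=
  { K.reflMap i with
    invFun := K.reflMap i
    left_inv := K.reflMap_invol i
    right_inv := K.reflMap_invol i }

/-- The Weyl group `W`, generated by the simple reflections. -/
def weylGroup : Subgroup (V ≃ₗ[ℝ] V) := Subgroup.closure (Set.range K.refl)

/-- The Weyl group orbit `W μ` of an integral weight. -/
def orbit (μ : V) : Set V := {ν | ∃ w ∈ K.weylGroup, ν = w μ}

/-- `Q_+ = Σ_i ℤ_{≥0} α_i`. -/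
def Qplus : Set V := {v | ∃ c : I → ℕ, v = ∑ i, (c i : ℝ) • K.α i}

/-- One step of the order on a Weyl group orbit:  `ν' = r_β(ν)` for a positive
real root `β = w α_i ∈ Q_+` (with `β∨ = w α_i∨`, `r_β = w r_i w⁻¹`) such that
`⟨ν, β∨⟩ < 0`. -/
def StepDown (ν ν' : V) : Prop :=
  ∃ w ∈ K.weylGroup, ∃ i : I, w (K.α i) ∈ K.Qplus ∧
    K.coroot i (w.symm ν) < 0 ∧ ν' = w (K.refl i (w.symm ν))

/-- There is a chain `ν = ξ_0, ξ_1, …, ξ_p = ν'` of steps down. -/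
def chainLen (p : ℕ) (ν ν' : V) : Prop :=
  ∃ ξ : ℕ → V, ξ 0 = ν ∧ ξ p = ν' ∧ ∀ q < p, K.StepDown (ξ q) (ξ (q + 1))

/-- `dist(ν, ν')`: the maximal length of a chain from `ν` down to `ν'`. -/
def dist (ν ν' : V) : ℕ := sSup {p | K.chainLen p ν ν'}

/-- A `σ`-chain for `(ν, ν')`: a sequence `ν = ξ_0 > ξ_1 > ⋯ > ξ_p = ν'` with
`dist(ξ_{q-1}, ξ_q) = 1` and `σ ⟨ξ_{q-1}, β_q∨⟩ ∈ ℤ_{<0}`, where `β_q` is the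
positive real root with `ξ_q = r_{β_q} ξ_{q-1}`. -/
def SigmaChain (σ : ℚ) (ν ν' : V) : Prop :=
  ∃ p : ℕ, 0 < p ∧ ∃ ξ : ℕ → V, ξ 0 = ν ∧ ξ p = ν' ∧
    ∀ q < p, K.dist (ξ q) (ξ (q + 1)) = 1 ∧
      ∃ w ∈ K.weylGroup, ∃ i : I, w (K.α i) ∈ K.Qplus ∧
        ξ (q + 1) = w (K.refl i (w.symm (ξ q))) ∧
        ∃ n : ℤ, n < 0 ∧ (σ : ℝ) * K.coroot i (w.symm (ξ q)) = (n : ℝ)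

/-- The combinatorial datum of a Lakshmibai–Seshadri path of shape `μ`:
a strictly decreasing sequence `ν_1 > ν_2 > ⋯ > ν_s` in `W μ` together with
rationals `0 = σ_0 < σ_1 < ⋯ < σ_s = 1` admitting `σ_u`-chains (the `ν`'s are
indexed here by `Fin s`, i.e. `0, …, s-1`). -/
structure LSData (K : KacMoodyData I V) (μ : V) where
  s : ℕ
  spos : 0 < s
  ν : Fin s → V
  τ : Fin (s + 1) → ℚ
  mem : ∀ u, ν u ∈ K.orbit μ
  strictDec : ∀ (u : ℕ) (h : u + 1 < s),
    Relation.TransGen K.StepDown (ν ⟨u, Nat.lt_of_succ_lt h⟩) (ν ⟨u + 1, h⟩)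
  τ_zero : τ 0 = 0
  τ_last : τ (Fin.last s) = 1
  τ_mono : StrictMono τ
  chainCond : ∀ (u : ℕ) (h : u + 1 < s),
    K.SigmaChain (τ ⟨u + 1, Nat.lt_succ_of_lt h⟩) (ν ⟨u, Nat.lt_of_succ_lt h⟩) (ν ⟨u + 1, h⟩)

/-- The piecewise-linear path `[0,1] → ℝ ⊗ P` associated with an LS datum:
`π(t) = Σ_{k<u} (σ_k - σ_{k-1}) ν_k + (t - σ_{u-1}) ν_u` for `σ_{u-1} ≤ t ≤ σ_u`,
encoded as the function `ℝ → V`, `t ↦ Σ_k (min t σ_{k+1} - min t σ_k) • ν_k`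
(which is constant for `t ≤ 0` and `t ≥ 1`). -/
def LSData.path {K : KacMoodyData I V} {μ : V} (π : K.LSData μ) : ℝ → V := fun t =>
  ∑ k : Fin π.s,
    ((min t ((π.τ k.succ : ℚ) : ℝ)) - (min t ((π.τ k.castSucc : ℚ) : ℝ))) • π.ν k

/-- `B(μ)`: the set of Lakshmibai–Seshadri paths of shape `μ`. -/
def B (μ : V) : Set (ℝ → V) := {f | ∃ π : K.LSData μ, f = π.path}

/-- `H_i^π(t) = ⟨π(t), α_i∨⟩`. -/
def H (i : I) (f : ℝ → V) : ℝ → ℝ := fun t => K.coroot i (f t)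

/-- `m_i^π = min {H_i^π(t) : t ∈ [0,1]}`. -/
def mval (i : I) (f : ℝ → V) : ℝ := sInf (K.H i f '' Set.Icc 0 1)

/-- The raising root operator `ẽ_i` (the underlying path, before testing
whether it is defined): with `t_1 = min {t : H_i^π(t) = m_i^π}` and
`t_0 = max {t ≤ t_1 : H_i^π(t) = m_i^π + 1}`, the new path is `π(t)` for
`t ≤ t_0`, `r_i(π(t) - π(t_0)) + π(t_0)` for `t_0 ≤ t ≤ t_1` and `π(t) + α_i`
for `t ≥ t_1`. -/
def eraw (i : I) (f : ℝ → V) : ℝ → V := fun t =>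
  let m := K.mval i f
  let t1 := sInf {t | t ∈ Set.Icc (0 : ℝ) 1 ∧ K.H i f t = m}
  let t0 := sSup {t | t ∈ Set.Icc (0 : ℝ) t1 ∧ K.H i f t = m + 1}
  if t ≤ t0 then f t
  else if t ≤ t1 then K.refl i (f t - f t0) + f t0
  else f t + K.α i

/-- The lowering root operator `f̃_i` (the underlying path): with
`t_0 = max {t : H_i^π(t) = m_i^π}` and `t_1 = min {t ≥ t_0 : H_i^π(t) = m_i^π + 1}`,
the new path is `π(t)` for `t ≤ t_0`, `r_i(π(t) - π(t_0)) + π(t_0)` for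
`t_0 ≤ t ≤ t_1` and `π(t) - α_i` for `t ≥ t_1`. -/
def fraw (i : I) (f : ℝ → V) : ℝ → V := fun t =>
  let m := K.mval i f
  let t0 := sSup {t | t ∈ Set.Icc (0 : ℝ) 1 ∧ K.H i f t = m}
  let t1 := sInf {t | t ∈ Set.Icc t0 1 ∧ K.H i f t = m + 1}
  if t ≤ t0 then f t
  else if t ≤ t1 then K.refl i (f t - f t0) + f t0
  else f t - K.α i

/-- The root operator `ẽ_i`, with value `none` (the formal element `0`) when
`m_i^π = 0`. -/
def eop (i : I) (f : ℝ → V) : Option (ℝ → V) :=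
  if K.mval i f = 0 then none else some (K.eraw i f)

/-- The root operator `f̃_i`, with value `none` (the formal element `0`) when
`H_i^π(1) - m_i^π = 0`. -/
def fop (i : I) (f : ℝ → V) : Option (ℝ → V) :=
  if K.H i f 1 - K.mval i f = 0 then none else some (K.fraw i f)

/-- `ẽ_i^n π` (with `ẽ_i 0 = 0`). -/
def eIter (i : I) (n : ℕ) (f : ℝ → V) : Option (ℝ → V) :=
  (fun o => o.bind (K.eop i))^[n] (some f)

/-- `f̃_i^n π` (with `f̃_i 0 = 0`). -/
def fIter (i : I) (n : ℕ) (f : ℝ → V) : Option (ℝ → V) :=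
  (fun o => o.bind (K.fop i))^[n] (some f)

/-- `ε_i(π) = max {n ≥ 0 : ẽ_i^n π ≠ 0}`. -/
def epsilon (i : I) (f : ℝ → V) : ℕ := sSup {n | K.eIter i n f ≠ none}

/-- `φ_i(π) = max {n ≥ 0 : f̃_i^n π ≠ 0}`. -/
def phi (i : I) (f : ℝ → V) : ℕ := sSup {n | K.fIter i n f ≠ none}

/-- The Weyl group action on a normal crystal:
`S_i b = f̃_i^{⟨wt b, α_i∨⟩} b` if `⟨wt b, α_i∨⟩ ≥ 0` and
`S_i b = ẽ_i^{-⟨wt b, α_i∨⟩} b` if `⟨wt b, α_i∨⟩ ≤ 0`. -/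
def Sop (i : I) (f : ℝ → V) : Option (ℝ → V) :=
  if 0 ≤ K.coroot i (f 1) then K.fIter i (⌊K.coroot i (f 1)⌋.toNat) f
  else K.eIter i ((-⌊K.coroot i (f 1)⌋).toNat) f

/-- `SWord K [i₁, …, i_k] b = S_{i₁} S_{i₂} ⋯ S_{i_k} b`. -/
def SWord (K : KacMoodyData I V) : List I → Option (ℝ → V) → Option (ℝ → V)
  | [], o => o
  | i :: rest, o => (SWord K rest o).bind (K.Sop i)

/-- `b` is extremal: for each `w ∈ W` (as a word in simple reflections) and
`i ∈ I`, `ẽ_i (S_w b) = 0` if `⟨wt (S_w b), α_i∨⟩ ≥ 0` and `f̃_i (S_w b) = 0`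
if `⟨wt (S_w b), α_i∨⟩ ≤ 0`. -/
def Extremal (f : ℝ → V) : Prop :=
  ∀ (l : List I) (g : ℝ → V), K.SWord l (some f) = some g →
    ∀ i : I, (0 ≤ K.coroot i (g 1) → K.eop i g = none) ∧
      (K.coroot i (g 1) ≤ 0 → K.fop i g = none)

/-- Application of a word in the Kashiwara operators (`true` stands for `ẽ`,
`false` for `f̃`), leftmost entry applied first. -/
def applyWord (K : KacMoodyData I V) :
    List (I × Bool) → Option (ℝ → V) → Option (ℝ → V)
  | [], o => o
  | p :: rest, o =>
      applyWord K rest (o.bind fun f => if p.2 then K.eop p.1 f else K.fop p.1 f)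

/-- `B(μ)^{*m}`: the set of `m`-fold concatenations of LS paths of shape `μ`. -/
def ConcatSet (μ : V) (m : ℕ) : Set (ℝ → V) :=
  {g | ∃ l : List (ℝ → V), l.length = m ∧ (∀ f ∈ l, f ∈ K.B μ) ∧ g = concatList l}

/-- `ε_i` of a tensor product (encoded as a list of paths, Kashiwara's rule):
`ε_i(b₁ ⊗ b₂) = max (ε_i b₁) (ε_i b₂ - ⟨wt b₁, α_i∨⟩)`. -/
def tensEps (K : KacMoodyData I V) (i : I) : List (ℝ → V) → ℤ
  | [] => 0
  | [b] => (K.epsilon i b : ℤ)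
  | b :: c :: rest =>
      max ((K.epsilon i b : ℤ)) (tensEps K i (c :: rest) - ⌊K.coroot i (b 1)⌋)

/-- `φ_i` of a tensor product (Kashiwara's rule):
`φ_i(b₁ ⊗ b₂) = max (φ_i b₂) (φ_i b₁ + ⟨wt b₂, α_i∨⟩)`. -/
def tensPhi (K : KacMoodyData I V) (i : I) : List (ℝ → V) → ℤ
  | [] => 0
  | [b] => (K.phi i b : ℤ)
  | b :: c :: rest =>
      max (tensPhi K i (c :: rest)) ((K.phi i b : ℤ) + ⌊K.coroot i (tensWt (c :: rest))⌋)

/-- `ẽ_i` on a tensor product (Kashiwara's rule):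
`ẽ_i(b₁ ⊗ b₂) = (ẽ_i b₁) ⊗ b₂` if `φ_i(b₁) ≥ ε_i(b₂)`, else `b₁ ⊗ (ẽ_i b₂)`. -/
def tensE (K : KacMoodyData I V) (i : I) : List (ℝ → V) → Option (List (ℝ → V))
  | [] => none
  | [b] => (K.eop i b).map fun b' => [b']
  | b :: c :: rest =>
      if K.tensEps i (c :: rest) ≤ (K.phi i b : ℤ) then
        (K.eop i b).map fun b' => b' :: c :: rest
      else (tensE K i (c :: rest)).map fun r' => b :: r'

/-- `f̃_i` on a tensor product (Kashiwara's rule):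
`f̃_i(b₁ ⊗ b₂) = (f̃_i b₁) ⊗ b₂` if `φ_i(b₁) > ε_i(b₂)`, else `b₁ ⊗ (f̃_i b₂)`. -/
def tensF (K : KacMoodyData I V) (i : I) : List (ℝ → V) → Option (List (ℝ → V))
  | [] => none
  | [b] => (K.fop i b).map fun b' => [b']
  | b :: c :: rest =>
      if K.tensEps i (c :: rest) < (K.phi i b : ℤ) then
        (K.fop i b).map fun b' => b' :: c :: rest
      else (tensF K i (c :: rest)).map fun r' => b :: r'

/-- `ẽ_i^n` on tensor products. -/
def tensEIter (i : I) (n : ℕ) (l : List (ℝ → V)) : Option (List (ℝ → V)) :=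
  (fun o => o.bind (K.tensE i))^[n] (some l)

/-- `f̃_i^n` on tensor products. -/
def tensFIter (i : I) (n : ℕ) (l : List (ℝ → V)) : Option (List (ℝ → V)) :=
  (fun o => o.bind (K.tensF i))^[n] (some l)

end KacMoodyData

end LSPaper

namespace LSPaper

namespace KacMoodyData

section WeylGroup

variable {I V : Type*} [Fintype I] [DecidableEq I] [AddCommGroup V] [Module ℝ V]
variable (K : KacMoodyData I V)

lemma refl_apply (i : I) (v : V) : K.refl i v = v - K.coroot i v • K.α i := rfl

lemma refl_mul_self (i : I) : K.refl i * K.refl i = 1 :=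
  LinearEquiv.ext (K.reflMap_invol i)

lemma refl_inv (i : I) : (K.refl i)⁻¹ = K.refl i :=
  inv_eq_of_mul_eq_one_left (K.refl_mul_self i)

lemma coroot_root_self (i : I) : K.coroot i (K.α i) = 2 := by
  rw [K.cartanPairing, K.diag]; norm_num

lemma refl_root_self (i : I) : K.refl i (K.α i) = -K.α i := by
  rw [refl_apply, coroot_root_self]; module

lemma coroot_refl (i : I) (v : V) : K.coroot i (K.refl i v) = -K.coroot i v := by
  rw [refl_apply, map_sub, map_smul, coroot_root_self, smul_eq_mul]; ring

/-- The Weyl group element given by a word in the simple reflections. -/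
def word (L : List I) : V ≃ₗ[ℝ] V := (L.map K.refl).prod

@[simp] lemma word_nil : K.word [] = 1 := rfl

@[simp] lemma word_cons (i : I) (L : List I) : K.word (i :: L) = K.refl i * K.word L := by
  simp [word]

@[simp] lemma word_append (L M : List I) : K.word (L ++ M) = K.word L * K.word M := by
  simp [word]

lemma refl_mem (i : I) : K.refl i ∈ K.weylGroup := Subgroup.subset_closure ⟨i, rfl⟩

lemma word_mem (L : List I) : K.word L ∈ K.weylGroup := by
  induction L with
  | nil => exact one_mem _
  | cons i L ih => rw [word_cons]; exact mul_mem (K.refl_mem i) ih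

lemma word_reverse (L : List I) : K.word L.reverse = (K.word L)⁻¹ := by
  induction L with
  | nil => simp
  | cons i L ih => simp [ih, refl_inv]

lemma exists_word {w : V ≃ₗ[ℝ] V} (hw : w ∈ K.weylGroup) : ∃ L, w = K.word L := by
  induction hw using Subgroup.closure_induction with
  | mem x hx => obtain ⟨i, rfl⟩ := hx; exact ⟨[i], by simp⟩
  | one => exact ⟨[], rfl⟩
  | mul x y _ _ hx hy =>
    obtain ⟨L, rfl⟩ := hx
    obtain ⟨M, rfl⟩ := hy
    exact ⟨L ++ M, by simp⟩
  | inv x _ hx =>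
    obtain ⟨L, rfl⟩ := hx
    exact ⟨L.reverse, (K.word_reverse L).symm⟩

/-- The graph of the `W`-equivariant map sending `α_i` to `d_i α_i∨`. -/
def rootCorootSpan : Submodule ℝ (V × (V →ₗ[ℝ] ℝ)) :=
  Submodule.span ℝ (Set.range fun k => (K.α k, (K.d k : ℝ) • K.coroot k))

lemma rootCorootSpan_refl (j : I) {p : V × (V →ₗ[ℝ] ℝ)} (hp : p ∈ K.rootCorootSpan) :
    (K.refl j p.1, p.2 ∘ₗ (K.refl j).toLinearMap) ∈ K.rootCorootSpan := by
  induction hp using Submodule.span_induction with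
  | mem x hx =>
    obtain ⟨k, rfl⟩ := hx
    have key : (K.refl j (K.α k), ((K.d k : ℝ) • K.coroot k) ∘ₗ (K.refl j).toLinearMap) =
        (K.α k, (K.d k : ℝ) • K.coroot k) -
          (K.a j k : ℝ) • (K.α j, (K.d j : ℝ) • K.coroot j) := by
      refine Prod.ext ?_ (LinearMap.ext fun v => ?_)
      · simp [refl_apply, K.cartanPairing]
      · have hs : (K.d k : ℝ) * K.a k j = K.d j * K.a j k := by
          exact_mod_cast K.symmetrizable k j
        simp [refl_apply, K.cartanPairing]
        linear_combination (-K.coroot j v) * hs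
    dsimp only
    rw [key]
    exact sub_mem (Submodule.subset_span ⟨k, rfl⟩)
      (Submodule.smul_mem _ _ (Submodule.subset_span ⟨j, rfl⟩))
  | zero =>
    convert zero_mem K.rootCorootSpan using 1
    simp
  | add x y _ _ hx hy =>
    convert add_mem hx hy using 1
    simp [LinearMap.add_comp]
  | smul c x _ hx =>
    convert Submodule.smul_mem _ c hx using 1
    simp [LinearMap.smul_comp]

lemma rootCorootSpan_word (L : List I) {p : V × (V →ₗ[ℝ] ℝ)} (hp : p ∈ K.rootCorootSpan) :
    (K.word L p.1, p.2 ∘ₗ (K.word L)⁻¹.toLinearMap) ∈ K.rootCorootSpan := by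
  induction L with
  | nil => exact hp
  | cons j L ih =>
    convert K.rootCorootSpan_refl j ih using 1
    rw [word_cons, mul_inv_rev, refl_inv]
    rfl

lemma rootCorootSpan_eq {i : I} {x : ℝ} {φ : V →ₗ[ℝ] ℝ}
    (h : (x • K.α i, φ) ∈ K.rootCorootSpan) : φ = (x * K.d i) • K.coroot i := by
  obtain ⟨c, hc⟩ := (Submodule.mem_span_range_iff_exists_fun ℝ).1 h
  have h1 : ∑ k, c k • K.α k = x • K.α i := by simpa [Prod.fst_sum] using congrArg Prod.fst hc
  have h2 : ∑ k, c k • (K.d k : ℝ) • K.coroot k = φ := by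
    simpa [Prod.snd_sum] using congrArg Prod.snd hc
  have h3 : ∑ k, (c k - (Pi.single i x : I → ℝ) k) • K.α k = 0 := by
    simp [sub_smul, Finset.sum_sub_distrib, h1, Pi.single_apply, ite_smul]
  have h4 : c = Pi.single i x :=
    funext fun k => sub_eq_zero.1 (Fintype.linearIndependent_iff.1 K.rootsIndep _ h3 k)
  rw [← h2, h4]
  simp [Pi.single_apply, ite_smul, smul_smul]

/-- If the root `w α_k` is proportional to `α_i`, so are the coroots. -/
lemma coroot_word_inv {L : List I} {k i : I} {x : ℝ} (h : K.word L (K.α k) = x • K.α i)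
    (v : V) : x * K.coroot k ((K.word L)⁻¹ v) = K.coroot i v := by
  have h1 := K.rootCorootSpan_word L (p := (K.α k, (K.d k : ℝ) • K.coroot k))
    (Submodule.subset_span ⟨k, rfl⟩)
  dsimp only at h1
  rw [h] at h1
  have h2 : ∀ v, (K.d k : ℝ) * K.coroot k ((K.word L)⁻¹ v) = x * K.d i * K.coroot i v :=
    fun v => by simpa using LinearMap.congr_fun (K.rootCorootSpan_eq h1) v
  have h3 := h2 (K.word L (K.α k))
  rw [← LinearEquiv.mul_apply, inv_mul_cancel, LinearEquiv.coe_one, id, coroot_root_self, h,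
    map_smul, coroot_root_self, smul_eq_mul] at h3
  have hk : (0 : ℝ) < K.d k := by exact_mod_cast K.dPos k
  have h4 : (K.d k : ℝ) = x ^ 2 * K.d i := by linarith
  have h5 : (K.d i : ℝ) ≠ 0 := by
    have := K.dPos i
    exact_mod_cast this.ne'
  have h6 : x ≠ 0 := by rintro rfl; simp at h4; exact hk.ne' (by exact_mod_cast h4)
  have h7 := h2 v
  rw [h4] at h7
  have h8 : x * K.d i ≠ 0 := mul_ne_zero h6 h5
  apply mul_left_cancel₀ h8
  linarith

lemma refl_mul_word {L : List I} {k i : I} {x : ℝ} (h : K.word L (K.α k) = x • K.α i) :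
    K.refl i * K.word L = K.word L * K.refl k := by
  refine LinearEquiv.ext fun v => ?_
  have h1 := K.coroot_word_inv h (K.word L v)
  rw [← LinearEquiv.mul_apply, inv_mul_cancel, LinearEquiv.coe_one, id] at h1
  rw [LinearEquiv.mul_apply, LinearEquiv.mul_apply, refl_apply, refl_apply, map_sub, map_smul, h,
    ← h1, smul_smul, mul_comm]

/-- Roots in a rank two subsystem, together with the invariance of their norm. -/
lemma word_pair_root {i j k : I} (hk : k = i ∨ k = j) (U : List I) (hU : ∀ s ∈ U, s = i ∨ s = j) :
    ∃ x y : ℤ, K.word U (K.α k) = (x : ℝ) • K.α i + (y : ℝ) • K.α j ∧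
      K.d i * x ^ 2 + K.d i * K.a i j * (x * y) + K.d j * y ^ 2 = K.d k := by
  induction U with
  | nil =>
    rcases hk with rfl | rfl
    · exact ⟨1, 0, by simp, by simp⟩
    · exact ⟨0, 1, by simp, by simp⟩
  | cons s U ih =>
    obtain ⟨x, y, h, hq⟩ := ih fun t ht => hU t (List.mem_cons_of_mem _ ht)
    have hs := K.symmetrizable i j
    rcases hU s List.mem_cons_self with rfl | rfl
    · refine ⟨-x - K.a s j * y, y, ?_, ?_⟩
      · rw [word_cons, LinearEquiv.mul_apply, h, refl_apply]
        simp only [map_add, map_smul, K.cartanPairing, smul_eq_mul]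
        push_cast
        simp only [K.diag]
        push_cast
        module
      · linear_combination hq
    · refine ⟨x, -y - K.a s i * x, ?_, ?_⟩
      · rw [word_cons, LinearEquiv.mul_apply, h, refl_apply]
        simp only [map_add, map_smul, K.cartanPairing, smul_eq_mul]
        push_cast
        simp only [K.diag]
        push_cast
        module
      · linear_combination hq + (-2 * x * y - K.a s i * x ^ 2) * hs

/-- In rank two, norms and integrality exclude roots with coefficients of mixed sign. -/
lemma not_mixed_sign {i j k : I} (hij : i ≠ j) (hk : k = i ∨ k = j) {x y : ℤ}
    (hq : K.d i * x ^ 2 + K.d i * K.a i j * (x * y) + K.d j * y ^ 2 = K.d k) : 0 ≤ x * y := by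
  by_contra! hxy
  have hi := K.dPos i
  have hj := K.dPos j
  have ha := K.offDiag i j hij
  have hx : 1 ≤ x ^ 2 := by
    have : x ≠ 0 := by rintro rfl; simp at hxy
    have := sq_pos_of_ne_zero this
    omega
  have hy : 1 ≤ y ^ 2 := by
    have : y ≠ 0 := by rintro rfl; simp at hxy
    have := sq_pos_of_ne_zero this
    omega
  have h1 : 0 ≤ K.d i * K.a i j * (x * y) :=
    mul_nonneg_of_nonpos_of_nonpos (mul_nonpos_of_nonneg_of_nonpos hi.le ha) hxy.le
  have h2 : K.d i ≤ K.d i * x ^ 2 := le_mul_of_one_le_right hi.le hx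
  have h3 : K.d j ≤ K.d j * y ^ 2 := le_mul_of_one_le_right hj.le hy
  rcases hk with rfl | rfl <;> linarith

/-- The exchange condition in rank two. -/
lemma pair_exchange {i j k : I} (hij : i ≠ j) (hk : k = i ∨ k = j) (U : List I)
    (hU : ∀ s ∈ U, s = i ∨ s = j) :
    (∃ x y : ℕ, K.word U (K.α k) = (x : ℝ) • K.α i + (y : ℝ) • K.α j) ∨
      ∃ U' : List I, (∀ s ∈ U', s = i ∨ s = j) ∧ U'.length < U.length ∧
        K.word U' = K.word U * K.refl k := by
  induction U with
  | nil =>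
    left
    rcases hk with rfl | rfl
    · exact ⟨1, 0, by simp⟩
    · exact ⟨0, 1, by simp⟩
  | cons s U ih =>
    have hU' : ∀ t ∈ U, t = i ∨ t = j := fun t ht => hU t (List.mem_cons_of_mem _ ht)
    have hs := hU s List.mem_cons_self
    rcases ih hU' with ⟨x, y, h⟩ | ⟨U', h1, h2, h3⟩
    · by_cases hx : ∃ x' : ℝ, K.word U (K.α k) = x' • K.α s
      · obtain ⟨x', hx'⟩ := hx
        exact Or.inr ⟨U, hU', by simp, by
          rw [word_cons, K.refl_mul_word hx', mul_assoc, refl_mul_self, mul_one]⟩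
      left
      obtain ⟨x', y', h', hq⟩ := K.word_pair_root hk (s :: U) hU
      have hsgn := K.not_mixed_sign hij hk hq
      have hli : LinearIndependent ℝ ![K.α i, K.α j] := by
        have := K.rootsIndep.comp ![i, j] (by
          intro p q hpq
          fin_cases p <;> fin_cases q <;> simp_all [eq_comm])
        convert this using 1
        ext p; fin_cases p <;> rfl
      have huniq := LinearIndependent.pair_iff.1 hli
      rw [word_cons, LinearEquiv.mul_apply, refl_apply, h] at h'
      suffices 0 ≤ x' ∧ 0 ≤ y' by
        refine ⟨x'.toNat, y'.toNat, ?_⟩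
        have e1 : ((x'.toNat : ℕ) : ℝ) = x' := by exact_mod_cast Int.toNat_of_nonneg this.1
        have e2 : ((y'.toNat : ℕ) : ℝ) = y' := by exact_mod_cast Int.toNat_of_nonneg this.2
        rw [e1, e2, ← h', word_cons, LinearEquiv.mul_apply, refl_apply, h]
      set c := K.coroot s ((x : ℝ) • K.α i + (y : ℝ) • K.α j)
      rcases hs with rfl | rfl
      · have hy : (y : ℤ) = y' := by
          have := (huniq (x - c - x') (y - y') (Eq.trans (by module) (sub_eq_zero.2 h'))).2
          exact_mod_cast sub_eq_zero.1 this
        have hy0 : y ≠ 0 := by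
          rintro rfl
          exact hx ⟨x, by simpa using h⟩
        have : 0 < y' := by omega
        exact ⟨nonneg_of_mul_nonneg_left hsgn this, this.le⟩
      · have hx1 : (x : ℤ) = x' := by
          have := (huniq (x - x') (y - c - y') (Eq.trans (by module) (sub_eq_zero.2 h'))).1
          exact_mod_cast sub_eq_zero.1 this
        have hx0 : x ≠ 0 := by
          rintro rfl
          exact hx ⟨y, by simpa using h⟩
        have : 0 < x' := by omega
        exact ⟨this.le, nonneg_of_mul_nonneg_right hsgn this⟩
    · refine Or.inr ⟨s :: U', ?_, by simpa using h2, by rw [word_cons, word_cons, h3, mul_assoc]⟩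
      intro t ht
      rcases List.mem_cons.1 ht with rfl | ht
      exacts [hs, h1 t ht]

lemma root_mem_Qplus (i : I) : K.α i ∈ K.Qplus :=
  ⟨Pi.single i 1, by simp [Pi.single_apply, ite_smul]⟩

lemma Qplus_add {v v' : V} (hv : v ∈ K.Qplus) (hv' : v' ∈ K.Qplus) : v + v' ∈ K.Qplus := by
  obtain ⟨c, rfl⟩ := hv
  obtain ⟨c', rfl⟩ := hv'
  exact ⟨c + c', by simp [add_smul, Finset.sum_add_distrib]⟩

lemma Qplus_smul (n : ℕ) {v : V} (hv : v ∈ K.Qplus) : (n : ℝ) • v ∈ K.Qplus := by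
  obtain ⟨c, rfl⟩ := hv
  exact ⟨fun k => n * c k, by simp [mul_smul, Finset.smul_sum]⟩

/-- Either `w α_k` is positive or `w r_k` has a shorter word than the given one for `w`. -/
lemma word_root_pos_or_shorter (n : ℕ) : ∀ (L : List I) (k : I), L.length = n →
    K.word L (K.α k) ∈ K.Qplus ∨
      ∃ L' : List I, L'.length < n ∧ K.word L' = K.word L * K.refl k := by
  induction n using Nat.strong_induction_on with
  | _ n ih =>
  intro L k hL
  rcases List.eq_nil_or_concat' L with rfl | ⟨L₁, j, rfl⟩
  · exact Or.inl (by simpa using K.root_mem_Qplus k)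
  rw [List.length_append, List.length_singleton] at hL
  rcases eq_or_ne k j with rfl | hkj
  · exact Or.inr ⟨L₁, by omega, by simp [mul_assoc, refl_mul_self]⟩
  let A : ℕ → Prop := fun m => ∃ M U : List I, M.length = m ∧ (∀ s ∈ U, s = k ∨ s = j) ∧
    K.word M * K.word U = K.word (L₁ ++ [j]) ∧ M.length + U.length ≤ n
  have hA : A L₁.length := ⟨L₁, [j], rfl, by simp, by simp, by simp; omega⟩
  have hne : ∃ m, A m := ⟨_, hA⟩
  obtain ⟨M, U, hM, hU, hw, hlen⟩ := Nat.find_spec hne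
  have hlt : M.length < n := by
    have := Nat.find_min' hne hA
    omega
  have hpos : ∀ s, s = k ∨ s = j → K.word M (K.α s) ∈ K.Qplus := by
    intro s hs
    refine (ih _ hlt M s rfl).resolve_right ?_
    rintro ⟨M', h1, h2⟩
    refine Nat.find_min hne (m := M'.length) (by omega) ⟨M', s :: U, rfl, ?_, ?_, ?_⟩
    · intro t ht
      rcases List.mem_cons.1 ht with rfl | ht
      exacts [hs, hU t ht]
    · rw [word_cons, h2, ← hw, mul_assoc, ← mul_assoc (K.refl s), refl_mul_self, one_mul]
    · simp only [List.length_cons]; omega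
  rcases K.pair_exchange hkj (Or.inl rfl) U hU with ⟨x, y, h⟩ | ⟨U', -, h1, h2⟩
  · left
    rw [← hw, LinearEquiv.mul_apply, h, map_add, map_smul, map_smul]
    exact K.Qplus_add (K.Qplus_smul _ (hpos _ (Or.inl rfl)))
      (K.Qplus_smul _ (hpos _ (Or.inr rfl)))
  · refine Or.inr ⟨M ++ U', ?_, ?_⟩
    · rw [List.length_append]; omega
    · rw [word_append, h2, ← hw, mul_assoc]

/-- Every real root is positive or negative. -/
lemma word_root_pos_or_neg (L : List I) (k : I) :
    K.word L (K.α k) ∈ K.Qplus ∨ -K.word L (K.α k) ∈ K.Qplus := by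
  induction hn : L.length using Nat.strong_induction_on generalizing L with
  | _ n ih =>
  subst hn
  rcases K.word_root_pos_or_shorter _ L k rfl with h | ⟨L', h1, h2⟩
  · exact Or.inl h
  have h3 : K.word L' (K.α k) = -K.word L (K.α k) := by
    rw [h2, LinearEquiv.mul_apply, refl_root_self, map_neg]
  have := ih _ h1 L' rfl
  rw [h3, neg_neg] at this
  exact this.symm

/-- A simple reflection `r_i` preserves positivity of real roots not proportional to `α_i`. -/
lemma refl_word_root {L : List I} {k : I} (i : I) (h : K.word L (K.α k) ∈ K.Qplus) :
    K.refl i (K.word L (K.α k)) ∈ K.Qplus ∨ ∃ n : ℕ, K.word L (K.α k) = (n : ℝ) • K.α i := by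
  rcases K.word_root_pos_or_neg (i :: L) k with h' | h'
  · exact Or.inl h'
  right
  obtain ⟨c, hc⟩ := h
  obtain ⟨c', hc'⟩ := h'
  rw [word_cons, LinearEquiv.mul_apply, refl_apply, hc] at hc'
  set b := K.coroot i (∑ k, (c k : ℝ) • K.α k)
  have h3 : ∑ k, ((c k : ℝ) + c' k - (Pi.single i b : I → ℝ) k) • K.α k = 0 := by
    simp only [sub_smul, add_smul, Finset.sum_sub_distrib, Finset.sum_add_distrib, ← hc']
    simp [Pi.single_apply, ite_smul]
  have h4 : ∀ k, k ≠ i → c k = 0 := by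
    intro k hk
    have := Fintype.linearIndependent_iff.1 K.rootsIndep _ h3 k
    rw [Pi.single_eq_of_ne hk, sub_zero] at this
    have : c k + c' k = 0 := by exact_mod_cast this
    omega
  refine ⟨c i, ?_⟩
  rw [hc]
  exact Finset.sum_eq_single i (fun k _ hk => by simp [h4 k hk]) (by simp)

end WeylGroup

/-- The integers as a subring of the reals. -/
abbrev intReal : Subring ℝ := (Int.castRingHom ℝ).range

lemma mem_intReal {x : ℝ} : x ∈ intReal ↔ ∃ n : ℤ, x = n := by
  simp [intReal, RingHom.mem_range, eq_comm]

lemma intCast_mem_intReal (n : ℤ) : (n : ℝ) ∈ intReal := mem_intReal.2 ⟨n, rfl⟩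

/-- The regularity of the functions `H_i^π` that makes the root operators well behaved: on every
subinterval the minimum is attained at an end point or is an integer. -/
structure IntegralMinima (h : ℝ → ℝ) : Prop where
  continuousOn : ContinuousOn h (Set.Icc 0 1)
  zero : h 0 = 0
  one : h 1 ∈ intReal
  minima : ∀ a b c, 0 ≤ a → a ≤ c → c ≤ b → b ≤ 1 →
    ∃ c', a ≤ c' ∧ c' ≤ b ∧ h c' ≤ h c ∧ (c' = a ∨ c' = b ∨ h c' ∈ intReal)

section LSPaths

variable {I V : Type*} [Fintype I] [DecidableEq I] [AddCommGroup V] [Module ℝ V]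
variable (K : KacMoodyData I V)

lemma Qplus_pairing_mem (i : I) {v : V} (hv : v ∈ K.Qplus) : K.coroot i v ∈ intReal := by
  obtain ⟨c, rfl⟩ := hv
  rw [map_sum]
  refine sum_mem fun k _ => ?_
  rw [map_smul, K.cartanPairing, smul_eq_mul]
  exact mul_mem (by exact_mod_cast intCast_mem_intReal (c k)) (intCast_mem_intReal _)

lemma orbit_subset {μ ν : V} (hμ : μ ∈ K.P) (hν : ν ∈ K.orbit μ) : ν ∈ K.P := by
  obtain ⟨w, hw, rfl⟩ := hν
  obtain ⟨L, rfl⟩ := K.exists_word hw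
  clear hw
  induction L with
  | nil => exact hμ
  | cons i L ih =>
    obtain ⟨n, hn⟩ := K.pairingInt i _ ih
    rw [word_cons, LinearEquiv.mul_apply, refl_apply, hn, Int.cast_smul_eq_zsmul]
    exact sub_mem ih (zsmul_mem (K.rootMem i) n)

lemma conj_refl_apply (w : V ≃ₗ[ℝ] V) (j : I) (ξ : V) :
    w (K.refl j (w.symm ξ)) = ξ - K.coroot j (w.symm ξ) • w (K.α j) := by
  rw [refl_apply, map_sub, map_smul, LinearEquiv.apply_symm_apply]

/-- A `dist`-one step crossing the wall of `α_i` is the reflection in `α_i`. -/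
lemma wall_crossing {i j : I} {ξ ξ' : V} {w : V ≃ₗ[ℝ] V} (hw : w ∈ K.weylGroup)
    (hpos : w (K.α j) ∈ K.Qplus) (hξ' : ξ' = w (K.refl j (w.symm ξ)))
    (hneg : K.coroot j (w.symm ξ) < 0) (hdist : K.dist ξ ξ' = 1)
    (h : K.coroot i ξ < 0) (h' : 0 < K.coroot i ξ') :
    ∃ n : ℕ, K.coroot i ξ = n * K.coroot j (w.symm ξ) := by
  obtain ⟨L, rfl⟩ := K.exists_word hw
  rcases K.refl_word_root i hpos with hr | ⟨n, hn⟩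
  · exfalso
    have hsymm : ∀ v, (K.word (i :: L)).symm (K.refl i v) = (K.word L).symm v := by
      intro v
      rw [LinearEquiv.symm_apply_eq, word_cons, LinearEquiv.mul_apply,
        LinearEquiv.apply_symm_apply]
    have hchain : K.chainLen 3 ξ ξ' := by
      refine ⟨fun q => if q = 0 then ξ else if q = 1 then K.refl i ξ else
        if q = 2 then K.refl i ξ' else ξ', by simp, by simp, ?_⟩
      intro q hq
      interval_cases q
      · exact ⟨1, one_mem _, i, K.root_mem_Qplus i, h, rfl⟩
      · refine ⟨K.word (i :: L), K.word_mem _, j, ?_, ?_, ?_⟩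
        · simpa using hr
        · simpa only [if_true, one_ne_zero, if_false, hsymm] using hneg
        · simp only [one_ne_zero, if_false, if_true, Nat.reduceAdd, hsymm]
          simp [hξ']
      · refine ⟨1, one_mem _, i, K.root_mem_Qplus i, ?_, ?_⟩
        · change K.coroot i (K.refl i ξ') < 0
          rw [coroot_refl]; linarith
        · exact (K.reflMap_invol i ξ').symm
    by_cases hb : BddAbove {p | K.chainLen p ξ ξ'}
    · have : 3 ≤ K.dist ξ ξ' := le_csSup hb hchain
      omega
    · rw [dist, Nat.sSup_of_not_bddAbove hb] at hdist
      omega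
  · exact ⟨n, (K.coroot_word_inv hn ξ).symm⟩

variable {K} in
lemma SigmaChain.pairing_mem {σ : ℚ} (hσ : 0 < σ) {ν ν' : V} (hc : K.SigmaChain σ ν ν') (i : I) :
    (σ : ℝ) * (K.coroot i ν - K.coroot i ν') ∈ intReal ∧
      (K.coroot i ν ≤ 0 → 0 ≤ K.coroot i ν' → (σ : ℝ) * K.coroot i ν ∈ intReal) := by
  obtain ⟨p, -, ξ, rfl, rfl, hstep⟩ := hc
  have hσ' : (0 : ℝ) < σ := by exact_mod_cast hσ
  have hdiff : ∀ q ≤ p, (σ : ℝ) * (K.coroot i (ξ 0) - K.coroot i (ξ q)) ∈ intReal := by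
    intro q hq
    induction q with
    | zero => simp
    | succ q ih =>
      obtain ⟨-, w, -, j, hpos, heq, n, -, hn⟩ := hstep q (by omega)
      have : (σ : ℝ) * (K.coroot i (ξ 0) - K.coroot i (ξ (q + 1))) =
          σ * (K.coroot i (ξ 0) - K.coroot i (ξ q)) + n * K.coroot i (w (K.α j)) := by
        rw [heq, conj_refl_apply, map_sub, map_smul, ← hn, smul_eq_mul]
        ring
      rw [this]
      exact add_mem (ih (by omega))
        (mul_mem (intCast_mem_intReal n) (K.Qplus_pairing_mem i hpos))
  refine ⟨hdiff p le_rfl, fun h0 hp => ?_⟩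
  suffices ∃ q ≤ p, (σ : ℝ) * K.coroot i (ξ q) ∈ intReal by
    obtain ⟨q, hq, hq'⟩ := this
    convert add_mem (hdiff q hq) hq' using 1
    ring
  have hex : ∃ q, 0 ≤ K.coroot i (ξ q) := ⟨p, hp⟩
  have hle : Nat.find hex ≤ p := Nat.find_min' hex hp
  have hspec := Nat.find_spec hex
  have hmin := fun m => Nat.find_min hex (m := m)
  generalize Nat.find hex = q at hle hspec hmin
  rcases q with _ | q
  · exact ⟨0, hle, by rw [le_antisymm h0 hspec]; simp⟩
  have hq : K.coroot i (ξ q) < 0 := not_le.1 (hmin q (by omega))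
  rcases hspec.eq_or_lt with hz | hlt
  · exact ⟨q + 1, hle, by rw [← hz]; simp⟩
  obtain ⟨hdist, w, hw, j, hpos, heq, n, hn0, hn⟩ := hstep q (by omega)
  have hneg : K.coroot j (w.symm (ξ q)) < 0 := by
    have : (n : ℝ) < 0 := by exact_mod_cast hn0
    rw [← hn] at this
    exact (pos_iff_neg_of_mul_neg this).1 hσ'
  obtain ⟨c, hc⟩ := K.wall_crossing hw hpos heq hneg hdist hq hlt
  refine ⟨q, by omega, ?_⟩
  rw [hc, mul_left_comm, hn]
  exact mul_mem (by exact_mod_cast intCast_mem_intReal c) (intCast_mem_intReal n)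

namespace LSData

variable {K} {μ : V} (π : K.LSData μ)

lemma H_path (i : I) (t : ℝ) : K.H i π.path t = ∑ k : Fin π.s,
    (min t (π.τ k.succ : ℝ) - min t (π.τ k.castSucc : ℝ)) * K.coroot i (π.ν k) := by
  simp [H, path, map_sum]

lemma continuous_H_path (i : I) : Continuous (K.H i π.path) := by
  rw [funext (π.H_path i)]
  fun_prop

lemma τ_le {j k : Fin (π.s + 1)} (h : j ≤ k) : (π.τ j : ℝ) ≤ π.τ k := by
  exact_mod_cast π.τ_mono.monotone h

lemma H_path_sub (i : I) (k : Fin π.s) {t t' : ℝ}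
    (h₁ : (π.τ k.castSucc : ℝ) ≤ t) (h₂ : t ≤ π.τ k.succ)
    (h₁' : (π.τ k.castSucc : ℝ) ≤ t') (h₂' : t' ≤ π.τ k.succ) :
    K.H i π.path t - K.H i π.path t' = (t - t') * K.coroot i (π.ν k) := by
  rw [H_path, H_path, ← Finset.sum_sub_distrib, Finset.sum_eq_single k]
  · rw [min_eq_left h₂, min_eq_left h₂', min_eq_right h₁, min_eq_right h₁']
    ring
  · intro j _ hjk
    rcases lt_or_gt_of_ne hjk with hj | hj
    · have e1 : (π.τ j.succ : ℝ) ≤ π.τ k.castSucc := π.τ_le (Fin.succ_le_castSucc_iff.2 hj)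
      have e2 : (π.τ j.castSucc : ℝ) ≤ π.τ j.succ := π.τ_le (Fin.castSucc_lt_succ).le
      rw [min_eq_right (e1.trans h₁), min_eq_right (e1.trans h₁'),
        min_eq_right ((e2.trans e1).trans h₁), min_eq_right ((e2.trans e1).trans h₁')]
      ring
    · have e1 : (π.τ k.succ : ℝ) ≤ π.τ j.castSucc := π.τ_le (Fin.succ_le_castSucc_iff.2 hj)
      have e2 : (π.τ j.castSucc : ℝ) ≤ π.τ j.succ := π.τ_le (Fin.castSucc_lt_succ).le
      rw [min_eq_left (h₂.trans e1), min_eq_left (h₂'.trans e1),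
        min_eq_left (h₂.trans (e1.trans e2)), min_eq_left (h₂'.trans (e1.trans e2))]
      ring
  · simp

lemma τ_zero_real : (π.τ 0 : ℝ) = 0 := by rw [π.τ_zero]; simp

lemma τ_last_real : (π.τ (Fin.last π.s) : ℝ) = 1 := by rw [π.τ_last]; simp

lemma H_path_zero (i : I) : K.H i π.path 0 = 0 := by
  rw [H_path]
  refine Finset.sum_eq_zero fun k _ => ?_
  have h : ∀ j, (0 : ℝ) ≤ π.τ j := fun j => by
    rw [← π.τ_zero_real]; exact π.τ_le (Fin.zero_le j)
  rw [min_eq_left (h _), min_eq_left (h _)]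
  simp

lemma τ_break_pos {n : ℕ} (hn : n + 1 < π.s) : 0 < π.τ ⟨n + 1, Nat.lt_succ_of_lt hn⟩ := by
  rw [← π.τ_zero]
  exact π.τ_mono (by simp [Fin.lt_def])

/-- At a break point, `H_i^π` agrees modulo integers with `σ_u ⟨ν_u, α_i∨⟩`. -/
lemma H_path_break (i : I) (n : ℕ) (hn : n < π.s) :
    K.H i π.path (π.τ (Fin.succ ⟨n, hn⟩)) -
      π.τ (Fin.succ ⟨n, hn⟩) * K.coroot i (π.ν ⟨n, hn⟩) ∈ intReal := by
  have hstep : ∀ (k : Fin π.s), K.H i π.path (π.τ k.succ) - K.H i π.path (π.τ k.castSucc) =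
      (π.τ k.succ - π.τ k.castSucc) * K.coroot i (π.ν k) := fun k =>
    π.H_path_sub i k (π.τ_le (Fin.castSucc_lt_succ).le) le_rfl le_rfl
      (π.τ_le (Fin.castSucc_lt_succ).le)
  induction n with
  | zero =>
    have h1 := hstep ⟨0, hn⟩
    have h2 : (Fin.castSucc (⟨0, hn⟩ : Fin π.s)) = 0 := rfl
    rw [h2, τ_zero_real, H_path_zero] at h1
    rw [show ∀ x y : ℝ, x - y = (x - 0) - y by intros; ring, h1]
    simp
  | succ n ih =>
    have h1 := hstep ⟨n + 1, hn⟩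
    have h2 : (Fin.castSucc (⟨n + 1, hn⟩ : Fin π.s)) = Fin.succ ⟨n, Nat.lt_of_succ_lt hn⟩ := rfl
    rw [h2] at h1
    have h3 := ((π.chainCond n hn).pairing_mem (π.τ_break_pos hn) i).1
    convert add_mem (ih (Nat.lt_of_succ_lt hn)) h3 using 1
    rw [show (⟨n + 1, Nat.lt_succ_of_lt hn⟩ : Fin (π.s + 1)) =
      Fin.succ ⟨n, Nat.lt_of_succ_lt hn⟩ from rfl]
    linear_combination h1

/-- Every point of `(0, 1]` lies in a half-open linear piece. -/
lemma exists_piece {c : ℝ} (h0 : 0 < c) (h1 : c ≤ 1) :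
    ∃ k : Fin π.s, (π.τ k.castSucc : ℝ) < c ∧ c ≤ π.τ k.succ := by
  have hex : ∃ n, ∃ h : n < π.s, c ≤ π.τ (Fin.succ ⟨n, h⟩) := by
    have hs := π.spos
    refine ⟨π.s - 1, by omega, ?_⟩
    rwa [show Fin.succ (⟨π.s - 1, by omega⟩ : Fin π.s) = Fin.last π.s by
      ext; simp; omega, τ_last_real]
  obtain ⟨h, hc⟩ := Nat.find_spec hex
  have hmin := fun m => Nat.find_min hex (m := m)
  generalize Nat.find hex = n at h hc hmin
  refine ⟨⟨n, h⟩, ?_, hc⟩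
  rcases n with _ | n
  · rwa [show Fin.castSucc (⟨0, h⟩ : Fin π.s) = 0 from rfl, τ_zero_real]
  · by_contra! hle
    exact hmin n (by omega) ⟨by omega, hle⟩

lemma integralMinima (hμ : μ ∈ K.P) (i : I) : IntegralMinima (K.H i π.path) where
  continuousOn := (π.continuous_H_path i).continuousOn
  zero := π.H_path_zero i
  one := by
    have hs := π.spos
    have h := π.H_path_break i (π.s - 1) (by omega)
    rw [show Fin.succ (⟨π.s - 1, by omega⟩ : Fin π.s) = Fin.last π.s by
      ext; simp; omega, τ_last_real, one_mul] at h
    obtain ⟨m, hm⟩ := K.pairingInt i _ (K.orbit_subset hμ (π.mem ⟨π.s - 1, by omega⟩))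
    convert add_mem h (mem_intReal.2 ⟨m, hm⟩) using 1
    ring
  minima := by
    intro a b c ha hac hcb hb
    have hcont := π.continuous_H_path i
    obtain ⟨m, hm, hmin⟩ := isCompact_Icc.exists_isMinOn (Set.nonempty_Icc.2 (hac.trans hcb))
      hcont.continuousOn
    have hcpt : IsCompact (Set.Icc a b ∩ K.H i π.path ⁻¹' {K.H i π.path m}) :=
      isCompact_Icc.inter_right (isClosed_singleton.preimage hcont)
    obtain ⟨c', ⟨⟨hac', hcb'⟩, hc'm⟩, hleast⟩ := hcpt.exists_isLeast ⟨m, hm, rfl⟩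
    have hmin' : ∀ x, a ≤ x → x ≤ b → K.H i π.path c' ≤ K.H i π.path x := by
      intro x hx hx'
      rw [show K.H i π.path c' = _ from hc'm]
      exact hmin ⟨hx, hx'⟩
    refine ⟨c', hac', hcb', hmin' c hac hcb, ?_⟩
    rcases hac'.eq_or_lt with rfl | hac'
    · exact Or.inl rfl
    rcases hcb'.eq_or_lt with rfl | hcb'
    · exact Or.inr (Or.inl rfl)
    right; right
    obtain ⟨k, hk1, hk2⟩ := π.exists_piece (ha.trans_lt hac') (hcb'.le.trans hb)
    have hslope : K.coroot i (π.ν k) < 0 := by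
      set x := max a (π.τ k.castSucc : ℝ)
      have hx : x < c' := max_lt hac' hk1
      have h1 := π.H_path_sub i k hk1.le hk2 (le_max_right a _) (hx.le.trans hk2)
      have h2 := hmin' x (le_max_left _ _) (hx.le.trans hcb'.le)
      have h3 : K.H i π.path c' ≠ K.H i π.path x := fun he =>
        hx.not_ge (hleast ⟨⟨le_max_left _ _, hx.le.trans hcb'.le⟩, he.symm.trans hc'm⟩)
      have h4 := lt_of_le_of_ne h2 h3
      have h5 : (c' - x) * K.coroot i (π.ν k) < 0 := by linarith
      exact (pos_iff_neg_of_mul_neg h5).1 (sub_pos.2 hx)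
    have hc'k : c' = π.τ k.succ := by
      by_contra hne
      have hlt := lt_of_le_of_ne hk2 hne
      have hx : c' < min b (π.τ k.succ : ℝ) := lt_min hcb' hlt
      have h1 := π.H_path_sub i k (hk1.le.trans hx.le) (min_le_right b _) hk1.le hk2
      have h2 := hmin' _ (hac'.le.trans hx.le) (min_le_left _ _)
      have h3 := mul_neg_of_pos_of_neg (sub_pos.2 hx) hslope
      linarith
    obtain ⟨n, hn⟩ := k
    have hbr := π.H_path_break i n hn
    rw [← hc'k] at hbr
    have hn1 : n + 1 < π.s := by
      by_contra hge
      rw [show Fin.succ (⟨n, hn⟩ : Fin π.s) = Fin.last π.s by ext; simp; omega,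
        τ_last_real] at hc'k
      linarith
    have hcast : Fin.castSucc (⟨n + 1, hn1⟩ : Fin π.s) = Fin.succ ⟨n, hn⟩ := rfl
    have hslope' : 0 ≤ K.coroot i (π.ν ⟨n + 1, hn1⟩) := by
      have hlt : c' < π.τ (Fin.succ ⟨n + 1, hn1⟩) := by
        rw [hc'k]
        exact_mod_cast π.τ_mono (by simp [Fin.lt_def])
      have hx : c' < min b (π.τ (Fin.succ ⟨n + 1, hn1⟩) : ℝ) := lt_min hcb' hlt
      have hle : (π.τ (Fin.castSucc ⟨n + 1, hn1⟩) : ℝ) ≤ c' := by rw [hcast, hc'k]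
      have h1 := π.H_path_sub i ⟨n + 1, hn1⟩ (hle.trans hx.le) (min_le_right b _) hle hlt.le
      have h2 := hmin' _ (hac'.le.trans hx.le) (min_le_left _ _)
      have h3 : 0 ≤ (min b (π.τ (Fin.succ ⟨n + 1, hn1⟩) : ℝ) - c') *
          K.coroot i (π.ν ⟨n + 1, hn1⟩) := by linarith
      exact nonneg_of_mul_nonneg_right h3 (sub_pos.2 hx)
    have h := ((π.chainCond n hn1).pairing_mem (π.τ_break_pos hn1) i).2 hslope.le hslope'
    rw [show (⟨n + 1, Nat.lt_succ_of_lt hn1⟩ : Fin (π.s + 1)) = Fin.succ ⟨n, hn⟩ from rfl,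
      ← hc'k] at h
    convert add_mem hbr h using 1
    ring

end LSData

end LSPaths

namespace IntegralMinima

variable {h : ℝ → ℝ}

lemma exists_isLeast (hh : IntegralMinima h) :
    ∃ m : ℤ, IsLeast (h '' Set.Icc 0 1) m := by
  obtain ⟨c, hc, hmin⟩ := isCompact_Icc.exists_isMinOn (Set.nonempty_Icc.2 zero_le_one)
    hh.continuousOn
  obtain ⟨c', h0, h1, hle, hc'⟩ := hh.minima 0 1 c le_rfl hc.1 hc.2 le_rfl
  have hint : h c' ∈ intReal := by
    rcases hc' with rfl | rfl | h'
    · rw [hh.zero]; exact zero_mem _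
    · exact hh.one
    · exact h'
  obtain ⟨m, hm⟩ := mem_intReal.1 hint
  refine ⟨m, hm ▸ ⟨c', ⟨h0, h1⟩, rfl⟩, ?_⟩
  rintro _ ⟨x, hx, rfl⟩
  rw [← hm]
  exact hle.trans (hmin hx)

/-- Reflecting a function with integral minima along a monotone piece between integral values. -/
lemma reflect (hh : IntegralMinima h) {t₀ t₁ : ℝ} (h0 : 0 ≤ t₀) (h01 : t₀ ≤ t₁) (h1 : t₁ ≤ 1)
    (hi₀ : h t₀ ∈ intReal) (hi₁ : h t₁ ∈ intReal)
    (hmono : MonotoneOn h (Set.Icc t₀ t₁) ∨ AntitoneOn h (Set.Icc t₀ t₁)) :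
    IntegralMinima fun t => if t ≤ t₀ then h t else if t ≤ t₁ then 2 * h t₀ - h t
      else h t + 2 * (h t₀ - h t₁) := by
  set g : ℝ → ℝ := fun t => if t ≤ t₀ then h t else if t ≤ t₁ then 2 * h t₀ - h t
      else h t + 2 * (h t₀ - h t₁) with hg
  have g₁ : ∀ t, t ≤ t₀ → g t = h t := fun t ht => if_pos ht
  have g₂ : ∀ t, t₀ ≤ t → t ≤ t₁ → g t = 2 * h t₀ - h t := by
    intro t ht ht'
    rcases ht.eq_or_lt with rfl | ht
    · rw [g₁ _ le_rfl]; ring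
    · simp only [hg, ht.not_ge, ht', if_true, if_false]
  have g₃ : ∀ t, t₁ ≤ t → g t = h t + 2 * (h t₀ - h t₁) := by
    intro t ht
    rcases ht.eq_or_lt with rfl | ht
    · rw [g₂ _ h01 le_rfl]; ring
    · simp only [hg, (h01.trans_lt ht).not_ge, ht.not_ge, if_false]
  have gi₀ : g t₀ ∈ intReal := by rwa [g₁ _ le_rfl]
  have htwo : (2 : ℝ) ∈ intReal := intCast_mem_intReal 2
  have gi₁ : g t₁ ∈ intReal := by
    rw [g₂ _ h01 le_rfl]; exact sub_mem (mul_mem htwo hi₀) hi₁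
  refine ⟨?_, ?_, ?_, ?_⟩
  · have hc := hh.continuousOn
    have e : Set.Icc (0 : ℝ) 1 = Set.Icc 0 t₀ ∪ (Set.Icc t₀ t₁ ∪ Set.Icc t₁ 1) := by
      rw [Set.Icc_union_Icc_eq_Icc h01 h1, Set.Icc_union_Icc_eq_Icc h0 (h01.trans h1)]
    rw [e]
    refine ContinuousOn.union_of_isClosed ?_ (ContinuousOn.union_of_isClosed ?_ ?_ isClosed_Icc
      isClosed_Icc) isClosed_Icc (isClosed_Icc.union isClosed_Icc)
    · exact (hc.mono (Set.Icc_subset_Icc le_rfl (h01.trans h1))).congr fun t ht => g₁ t ht.2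
    · exact (continuousOn_const.sub (hc.mono (Set.Icc_subset_Icc h0 h1))).congr
        fun t ht => g₂ t ht.1 ht.2
    · exact ((hc.mono (Set.Icc_subset_Icc (h0.trans h01) le_rfl)).add continuousOn_const).congr
        fun t ht => g₃ t ht.1
  · rw [g₁ 0 h0, hh.zero]
  · rw [g₃ 1 h1]
    exact add_mem hh.one (mul_mem htwo (sub_mem hi₀ hi₁))
  · intro a b c ha hac hcb hb
    rcases le_total c t₀ with hc₀ | hc₀
    · obtain ⟨c', h2, h3, h4, h5⟩ := hh.minima a (min b t₀) c ha hac (le_min hcb hc₀)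
        ((min_le_left _ _).trans hb)
      have h6 : c' ≤ t₀ := h3.trans (min_le_right _ _)
      refine ⟨c', h2, h3.trans (min_le_left _ _), by rwa [g₁ _ h6, g₁ _ hc₀], ?_⟩
      rcases h5 with h5 | h5 | h5
      · exact Or.inl h5
      · rcases min_choice b t₀ with he | he <;> rw [he] at h5
        · exact Or.inr (Or.inl h5)
        · right; right; rwa [h5]
      · right; right; rwa [g₁ _ h6]
    rcases le_total c t₁ with hc₁ | hc₁
    · rcases hmono with hm | hm
      · refine ⟨min b t₁, hac.trans (le_min hcb hc₁), min_le_left _ _, ?_, ?_⟩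
        · have h2 : c ≤ min b t₁ := le_min hcb hc₁
          rw [g₂ _ (hc₀.trans h2) (min_le_right _ _), g₂ _ hc₀ hc₁]
          have := hm ⟨hc₀, hc₁⟩ ⟨hc₀.trans h2, min_le_right _ _⟩ h2
          linarith
        · rcases min_choice b t₁ with he | he <;> rw [he]
          · exact Or.inr (Or.inl rfl)
          · exact Or.inr (Or.inr gi₁)
      · refine ⟨max a t₀, le_max_left _ _, (max_le hac hc₀).trans hcb, ?_, ?_⟩
        · have h2 : max a t₀ ≤ c := max_le hac hc₀
          rw [g₂ _ (le_max_right _ _) (h2.trans hc₁), g₂ _ hc₀ hc₁]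
          have := hm ⟨le_max_right _ _, h2.trans hc₁⟩ ⟨hc₀, hc₁⟩ h2
          linarith
        · rcases max_choice a t₀ with he | he <;> rw [he]
          · exact Or.inl rfl
          · exact Or.inr (Or.inr gi₀)
    · obtain ⟨c', h2, h3, h4, h5⟩ := hh.minima (max a t₁) b c (ha.trans (le_max_left _ _))
        (max_le hac hc₁) hcb hb
      have h6 : t₁ ≤ c' := (le_max_right _ _).trans h2
      refine ⟨c', (le_max_left _ _).trans h2, h3, by rw [g₃ _ h6, g₃ _ hc₁]; linarith, ?_⟩
      rcases h5 with h5 | h5 | h5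
      · rcases max_choice a t₁ with he | he <;> rw [he] at h5
        · exact Or.inl h5
        · right; right; rwa [h5]
      · exact Or.inr (Or.inl h5)
      · right; right
        rw [g₃ _ h6]
        exact add_mem h5 (mul_mem htwo (sub_mem hi₀ hi₁))

lemma isCompact_level (hh : IntegralMinima h) {a b : ℝ} (ha : 0 ≤ a) (hb : b ≤ 1) (y : ℝ) :
    IsCompact {t | t ∈ Set.Icc a b ∧ h t = y} := by
  have : IsClosed (Set.Icc a b ∩ h ⁻¹' {y}) :=
    (hh.continuousOn.mono (Set.Icc_subset_Icc ha hb)).preimage_isClosed_of_isClosed isClosed_Icc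
      isClosed_singleton
  exact isCompact_Icc.of_isClosed_subset this Set.inter_subset_left

lemma eq_of_mem_of_lt {m : ℤ} {x : ℝ} (hx : x ∈ intReal) (h1 : (m : ℝ) ≤ x) (h2 : x < m + 1) :
    x = m := by
  obtain ⟨n, rfl⟩ := mem_intReal.1 hx
  have e1 : m ≤ n := by exact_mod_cast h1
  have e2 : n < m + 1 := by exact_mod_cast h2
  have : n = m := by omega
  rw [this]

/-- The effect on `H_i^π` of the raising operator. -/
lemma raise (hh : IntegralMinima h) {m : ℤ} (hm : IsLeast (h '' Set.Icc 0 1) m) (hm0 : m ≠ 0) :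
    let t₁ := sInf {t | t ∈ Set.Icc (0 : ℝ) 1 ∧ h t = m}
    let t₀ := sSup {t | t ∈ Set.Icc (0 : ℝ) t₁ ∧ h t = m + 1}
    let g : ℝ → ℝ := fun t => if t ≤ t₀ then h t else if t ≤ t₁ then 2 * h t₀ - h t
      else h t + 2
    IntegralMinima g ∧ IsLeast (g '' Set.Icc 0 1) (m + 1) := by
  intro t₁ t₀ g
  have hmin : ∀ t, 0 ≤ t → t ≤ 1 → (m : ℝ) ≤ h t := fun t ht ht' => hm.2 ⟨t, ⟨ht, ht'⟩, rfl⟩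
  have hm1 : m ≤ -1 := by
    have : (m : ℝ) ≤ 0 := by simpa [hh.zero] using hmin 0 le_rfl zero_le_one
    have : m ≤ 0 := by exact_mod_cast this
    omega
  have hm1' : (m : ℝ) ≤ -1 := by exact_mod_cast hm1
  have hT₁ : IsLeast {t | t ∈ Set.Icc (0 : ℝ) 1 ∧ h t = m} t₁ := by
    obtain ⟨c, hc, hc'⟩ := hm.1
    exact (hh.isCompact_level le_rfl le_rfl m).isLeast_sInf ⟨c, hc, hc'⟩
  obtain ⟨⟨h₁0, h₁1⟩, ht₁⟩ := hT₁.1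
  have hT₀ : IsGreatest {t | t ∈ Set.Icc (0 : ℝ) t₁ ∧ h t = m + 1} t₀ := by
    refine (hh.isCompact_level le_rfl h₁1 _).isGreatest_sSup ?_
    obtain ⟨c, hc, hc'⟩ := intermediate_value_Icc' h₁0
      (hh.continuousOn.mono (Set.Icc_subset_Icc le_rfl h₁1))
      (show (m : ℝ) + 1 ∈ Set.Icc (h t₁) (h 0) by
        rw [ht₁, hh.zero]; constructor <;> linarith)
    exact ⟨c, hc, hc'⟩
  obtain ⟨⟨h₀0, h₀₁⟩, ht₀⟩ := hT₀.1
  have hlt : ∀ t, 0 ≤ t → t ≤ t₁ → h t < m + 1 → h t ∈ intReal → t = t₁ := by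
    intro t h0 h1 h2 h3
    exact le_antisymm h1 (hT₁.2 ⟨⟨h0, h1.trans h₁1⟩,
      eq_of_mem_of_lt h3 (hmin t h0 (h1.trans h₁1)) h2⟩)
  have hne : t₀ ≠ t₁ := by
    intro he
    rw [he, ht₁] at ht₀
    linarith
  have hlow : ∀ t, 0 ≤ t → t ≤ t₀ → (m : ℝ) + 1 ≤ h t := by
    intro t h0 h1
    by_contra! hc
    obtain ⟨c, h2, h3, h4, h5⟩ := hh.minima 0 t₀ t le_rfl h0 h1 (h₀₁.trans h₁1)
    rcases h5 with rfl | rfl | h5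
    · rw [hh.zero] at h4; linarith
    · linarith
    · exact hne (le_antisymm h₀₁ ((hlt c h2 (h3.trans h₀₁) (h4.trans_lt hc) h5) ▸ h3))
  have hup : ∀ t, t₀ ≤ t → t ≤ t₁ → h t ≤ m + 1 := by
    intro t h0 h1
    by_contra! hc
    obtain ⟨c, hc1, hc2⟩ := intermediate_value_Icc' h1
      (hh.continuousOn.mono (Set.Icc_subset_Icc (h₀0.trans h0) h₁1))
      (show (m : ℝ) + 1 ∈ Set.Icc (h t₁) (h t) by
        rw [ht₁]; constructor <;> linarith)
    have h2 : c ≤ t₀ := hT₀.2 ⟨⟨(h₀0.trans h0).trans hc1.1, hc1.2⟩, hc2⟩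
    have h3 : t = t₀ := le_antisymm (hc1.1.trans h2) h0
    rw [h3, ht₀] at hc
    exact lt_irrefl _ hc
  have hanti : AntitoneOn h (Set.Icc t₀ t₁) := by
    intro s hs t ht hst
    by_contra! hc
    obtain ⟨c, h2, h3, h4, h5⟩ := hh.minima t₀ t s h₀0 hs.1 hst (ht.2.trans h₁1)
    have h6 := hup t ht.1 ht.2
    rcases h5 with rfl | rfl | h5
    · linarith
    · linarith
    · have h7 := hlt c (h₀0.trans h2) (h3.trans ht.2) (by linarith) h5
      have h8 : t = t₁ := le_antisymm ht.2 (h7 ▸ h3)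
      rw [h7] at h4
      rw [h8] at hc
      linarith
  have hi₀ : h t₀ ∈ intReal := by rw [ht₀]; exact_mod_cast intCast_mem_intReal (m + 1)
  have hi₁ : h t₁ ∈ intReal := by rw [ht₁]; exact intCast_mem_intReal m
  refine ⟨?_, ⟨t₀, ⟨h₀0, h₀₁.trans h₁1⟩, ?_⟩, ?_⟩
  · have := hh.reflect h₀0 h₀₁ h₁1 hi₀ hi₁ (Or.inr hanti)
    rw [show 2 * (h t₀ - h t₁) = 2 by rw [ht₀, ht₁]; ring] at this
    exact this
  · simp only [g, le_refl, if_true]; exact ht₀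
  · rintro _ ⟨t, ⟨h0, h1⟩, rfl⟩
    simp only [g]
    split_ifs with h2 h3
    · exact hlow t h0 h2
    · have := hup t (not_le.1 h2).le h3
      linarith
    · have := hmin t h0 h1
      linarith

/-- The effect on `H_i^π` of the lowering operator. -/
lemma lower (hh : IntegralMinima h) {m : ℤ} (hm : IsLeast (h '' Set.Icc 0 1) m) (hm1 : h 1 ≠ m) :
    let t₀ := sSup {t | t ∈ Set.Icc (0 : ℝ) 1 ∧ h t = m}
    let t₁ := sInf {t | t ∈ Set.Icc t₀ 1 ∧ h t = m + 1}
    let g : ℝ → ℝ := fun t => if t ≤ t₀ then h t else if t ≤ t₁ then 2 * h t₀ - h t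
      else h t - 2
    IntegralMinima g ∧ IsLeast (g '' Set.Icc 0 1) (m - 1) ∧ g 1 = h 1 - 2 := by
  intro t₀ t₁ g
  have hmin : ∀ t, 0 ≤ t → t ≤ 1 → (m : ℝ) ≤ h t := fun t ht ht' => hm.2 ⟨t, ⟨ht, ht'⟩, rfl⟩
  have hone : (m : ℝ) + 1 ≤ h 1 := by
    by_contra! hc
    exact hm1 (eq_of_mem_of_lt hh.one (hmin 1 zero_le_one le_rfl) hc)
  have hT₀ : IsGreatest {t | t ∈ Set.Icc (0 : ℝ) 1 ∧ h t = m} t₀ := by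
    obtain ⟨c, hc, hc'⟩ := hm.1
    exact (hh.isCompact_level le_rfl le_rfl m).isGreatest_sSup ⟨c, hc, hc'⟩
  obtain ⟨⟨h₀0, h₀1⟩, ht₀⟩ := hT₀.1
  have hT₁ : IsLeast {t | t ∈ Set.Icc t₀ 1 ∧ h t = m + 1} t₁ := by
    refine (hh.isCompact_level h₀0 le_rfl _).isLeast_sInf ?_
    obtain ⟨c, hc, hc'⟩ := intermediate_value_Icc h₀1
      (hh.continuousOn.mono (Set.Icc_subset_Icc h₀0 le_rfl))
      (show (m : ℝ) + 1 ∈ Set.Icc (h t₀) (h 1) by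
        rw [ht₀]; constructor <;> linarith)
    exact ⟨c, hc, hc'⟩
  obtain ⟨⟨h₀₁, h₁1⟩, ht₁⟩ := hT₁.1
  have hlt : ∀ t, t₀ ≤ t → t ≤ 1 → h t < m + 1 → h t ∈ intReal → t = t₀ := by
    intro t h0 h1 h2 h3
    exact le_antisymm (hT₀.2 ⟨⟨h₀0.trans h0, h1⟩,
      eq_of_mem_of_lt h3 (hmin t (h₀0.trans h0) h1) h2⟩) h0
  have hne : t₀ ≠ t₁ := by
    intro he
    rw [← he, ht₀] at ht₁
    linarith
  have hlow : ∀ t, t₁ ≤ t → t ≤ 1 → (m : ℝ) + 1 ≤ h t := by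
    intro t h0 h1
    by_contra! hc
    obtain ⟨c, h2, h3, h4, h5⟩ := hh.minima t₁ 1 t (h₀0.trans h₀₁) h0 h1 le_rfl
    rcases h5 with rfl | rfl | h5
    · linarith
    · linarith
    · exact hne (le_antisymm h₀₁ ((hlt c (h₀₁.trans h2) h3 (h4.trans_lt hc) h5) ▸ h2))
  have hup : ∀ t, t₀ ≤ t → t ≤ t₁ → h t ≤ m + 1 := by
    intro t h0 h1
    by_contra! hc
    obtain ⟨c, hc1, hc2⟩ := intermediate_value_Icc h0
      (hh.continuousOn.mono (Set.Icc_subset_Icc h₀0 (h1.trans h₁1)))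
      (show (m : ℝ) + 1 ∈ Set.Icc (h t₀) (h t) by
        rw [ht₀]; constructor <;> linarith)
    have h2 : t₁ ≤ c := hT₁.2 ⟨⟨hc1.1, hc1.2.trans (h1.trans h₁1)⟩, hc2⟩
    have h3 : t = t₁ := le_antisymm h1 (h2.trans hc1.2)
    rw [h3, ht₁] at hc
    exact lt_irrefl _ hc
  have hmono : MonotoneOn h (Set.Icc t₀ t₁) := by
    intro s hs t ht hst
    by_contra! hc
    obtain ⟨c, h2, h3, h4, h5⟩ := hh.minima s t₁ t (h₀0.trans hs.1) hst ht.2 h₁1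
    have h6 := hup s hs.1 hs.2
    rcases h5 with rfl | rfl | h5
    · linarith
    · linarith
    · have h7 := hlt c (hs.1.trans h2) (h3.trans h₁1) (by linarith) h5
      have h8 : s = t₀ := le_antisymm (h7 ▸ h2) hs.1
      rw [h7] at h4
      rw [h8] at hc
      linarith
  have hi₀ : h t₀ ∈ intReal := by rw [ht₀]; exact intCast_mem_intReal m
  have hi₁ : h t₁ ∈ intReal := by rw [ht₁]; exact_mod_cast intCast_mem_intReal (m + 1)
  have hlt01 : t₀ < t₁ := lt_of_le_of_ne h₀₁ hne
  refine ⟨?_, ⟨⟨t₁, ⟨h₀0.trans h₀₁, h₁1⟩, ?_⟩, ?_⟩, ?_⟩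
  · have := hh.reflect h₀0 h₀₁ h₁1 hi₀ hi₁ (Or.inl hmono)
    rw [show 2 * (h t₀ - h t₁) = -2 by rw [ht₀, ht₁]; ring] at this
    exact this
  · simp only [g, hlt01.not_ge, le_refl, if_true, if_false, ht₀, ht₁]
    ring
  · rintro _ ⟨t, ⟨h0, h1⟩, rfl⟩
    simp only [g]
    split_ifs with h2 h3
    · have := hmin t h0 h1
      linarith
    · have := hup t (not_le.1 h2).le h3
      linarith
    · have := hlow t (not_le.1 h3).le h1
      linarith
  · simp only [g, (hlt01.trans_le h₁1).not_ge, if_false]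
    split_ifs with h2
    · have h3 : t₁ = 1 := le_antisymm h₁1 h2
      rw [h3] at ht₁
      linarith
    · rfl

end IntegralMinima

section RootOperators

variable {I V : Type*} [Fintype I] [DecidableEq I] [AddCommGroup V] [Module ℝ V]
variable (K : KacMoodyData I V)

lemma H_eraw (i : I) (f : ℝ → V) : K.H i (K.eraw i f) = fun t =>
    let t₁ := sInf {t | t ∈ Set.Icc (0 : ℝ) 1 ∧ K.H i f t = K.mval i f}
    let t₀ := sSup {t | t ∈ Set.Icc (0 : ℝ) t₁ ∧ K.H i f t = K.mval i f + 1}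
    if t ≤ t₀ then K.H i f t else if t ≤ t₁ then 2 * K.H i f t₀ - K.H i f t
      else K.H i f t + 2 := by
  funext t
  change K.coroot i (K.eraw i f t) = _
  dsimp only [eraw]
  split_ifs
  · rfl
  · rw [map_add, coroot_refl, map_sub]
    simp only [H]
    ring
  · rw [map_add, coroot_root_self, H]

lemma H_fraw (i : I) (f : ℝ → V) : K.H i (K.fraw i f) = fun t =>
    let t₀ := sSup {t | t ∈ Set.Icc (0 : ℝ) 1 ∧ K.H i f t = K.mval i f}
    let t₁ := sInf {t | t ∈ Set.Icc t₀ 1 ∧ K.H i f t = K.mval i f + 1}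
    if t ≤ t₀ then K.H i f t else if t ≤ t₁ then 2 * K.H i f t₀ - K.H i f t
      else K.H i f t - 2 := by
  funext t
  change K.coroot i (K.fraw i f t) = _
  dsimp only [fraw]
  split_ifs
  · rfl
  · rw [map_add, coroot_refl, map_sub]
    simp only [H]
    ring
  · rw [map_sub, coroot_root_self, H]

variable {K} in
lemma isLeast_mval {i : I} {f : ℝ → V} (hf : IntegralMinima (K.H i f)) :
    ∃ m : ℤ, K.mval i f = m ∧ IsLeast (K.H i f '' Set.Icc 0 1) m := by
  obtain ⟨m, hm⟩ := hf.exists_isLeast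
  exact ⟨m, hm.csInf_eq, hm⟩

/-- If `op` lowers a counter by one and vanishes exactly when the counter is zero, then the
counter is the maximal number of times `op` can be applied. -/
lemma sSup_iterate_eq {α : Type*} (op : α → Option α) (S : ℕ → α → Prop)
    (hzero : ∀ x, S 0 x → op x = none)
    (hsucc : ∀ n x, S (n + 1) x → ∃ y, op x = some y ∧ S n y) {N : ℕ} {x : α} (hx : S N x) :
    sSup {n | (fun o : Option α => o.bind op)^[n] (some x) ≠ none} = N := by
  have hnone : ∀ n, (fun o : Option α => o.bind op)^[n] none = none := fun n =>
    Function.iterate_fixed rfl n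
  have key : ∀ N x, S N x → ∀ n,
      (fun o : Option α => o.bind op)^[n] (some x) ≠ none ↔ n ≤ N := by
    intro N
    induction N with
    | zero =>
      intro x hx n
      cases n with
      | zero => simp
      | succ n => simp [Function.iterate_succ_apply, hzero x hx, hnone]
    | succ N ih =>
      intro x hx n
      cases n with
      | zero => simp
      | succ n =>
        obtain ⟨y, hy, hS⟩ := hsucc N x hx
        rw [Function.iterate_succ_apply, Option.bind_some, hy, ih y hS, Nat.succ_le_succ_iff]
  have : {n | (fun o : Option α => o.bind op)^[n] (some x) ≠ none} = Set.Iic N :=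
    Set.ext fun n => key N x hx n
  rw [this, csSup_Iic]

variable {K} in
lemma epsilon_eq {i : I} {f : ℝ → V} (hf : IntegralMinima (K.H i f)) :
    (K.epsilon i f : ℝ) = -K.mval i f := by
  obtain ⟨m, hm, hleast⟩ := isLeast_mval hf
  have hm0 : m ≤ 0 := by
    have : (m : ℝ) ≤ 0 := hleast.2 ⟨0, by simp, hf.zero⟩
    exact_mod_cast this
  have h := sSup_iterate_eq (K.eop i)
    (fun n g => IntegralMinima (K.H i g) ∧ K.mval i g = -n) (N := (-m).toNat) (x := f)
    (fun g hg => by simp [eop, hg.2]) ?_ ⟨hf, ?_⟩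
  · have e : K.epsilon i f = (-m).toNat := h
    rw [e, hm]
    exact_mod_cast Int.toNat_of_nonneg (neg_nonneg.2 hm0)
  · rintro n g ⟨hg, hn⟩
    obtain ⟨p, hp, hpl⟩ := isLeast_mval hg
    have hpn : p = -(n + 1) := by
      rw [hp] at hn
      exact_mod_cast hn
    have hp0 : p ≠ 0 := by omega
    refine ⟨K.eraw i g, if_neg (by rw [hp]; exact_mod_cast hp0), ?_⟩
    have hr : IntegralMinima (K.H i (K.eraw i g)) ∧
        IsLeast (K.H i (K.eraw i g) '' Set.Icc 0 1) (K.mval i g + 1) := by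
      rw [H_eraw, hp]
      exact hg.raise hpl hp0
    refine ⟨hr.1, ?_⟩
    rw [mval, hr.2.csInf_eq, hn]
    push_cast
    ring
  · rw [hm]
    have : ((-m).toNat : ℤ) = -m := Int.toNat_of_nonneg (neg_nonneg.2 hm0)
    have : (((-m).toNat : ℕ) : ℝ) = -m := by exact_mod_cast this
    rw [this, neg_neg]

variable {K} in
lemma phi_eq {i : I} {f : ℝ → V} (hf : IntegralMinima (K.H i f)) :
    (K.phi i f : ℝ) = K.H i f 1 - K.mval i f := by
  obtain ⟨m, hm, hleast⟩ := isLeast_mval hf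
  obtain ⟨r, hr⟩ := mem_intReal.1 hf.one
  have hmr : 0 ≤ r - m := by
    have : (m : ℝ) ≤ r := hr ▸ hleast.2 ⟨1, by simp, rfl⟩
    have : m ≤ r := by exact_mod_cast this
    omega
  have hcast : (((r - m).toNat : ℕ) : ℝ) = r - m := by
    exact_mod_cast Int.toNat_of_nonneg hmr
  have h := sSup_iterate_eq (K.fop i)
    (fun n g => IntegralMinima (K.H i g) ∧ K.H i g 1 - K.mval i g = n) (N := (r - m).toNat)
    (x := f) (fun g hg => by simp [fop, hg.2]) ?_ ⟨hf, ?_⟩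
  · have e : K.phi i f = (r - m).toNat := h
    rw [e, hm, hr, hcast]
  · rintro n g ⟨hg, hn⟩
    obtain ⟨p, hp, hpl⟩ := isLeast_mval hg
    have hne : K.H i g 1 - K.mval i g ≠ 0 := by
      rw [hn]
      exact_mod_cast n.succ_ne_zero
    refine ⟨K.fraw i g, if_neg hne, ?_⟩
    have hl : IntegralMinima (K.H i (K.fraw i g)) ∧
        IsLeast (K.H i (K.fraw i g) '' Set.Icc 0 1) (K.mval i g - 1) ∧
          K.H i (K.fraw i g) 1 = K.H i g 1 - 2 := by
      rw [sub_ne_zero, hp] at hne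
      rw [H_fraw, hp]
      exact hg.lower hpl hne
    refine ⟨hl.1, ?_⟩
    rw [mval, hl.2.1.csInf_eq, hl.2.2]
    push_cast at hn
    linarith
  · rw [hm, hr, hcast]

end RootOperators

end KacMoodyData

end LSPaper

open LSPaper in
theorem statement3 {I V : Type*} [Fintype I] [DecidableEq I] [AddCommGroup V] [Module ℝ V]
    (K : KacMoodyData I V) (μ : V) (hμ : μ ∈ K.P)
    (f : ℝ → V) (hf : f ∈ K.B μ) (i : I) :
    (K.epsilon i f : ℝ) = -(K.mval i f) ∧
    (K.phi i f : ℝ) = K.H i f 1 - K.mval i f := by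
  obtain ⟨π, rfl⟩ := hf
  have h := π.integralMinima hμ i
  exact ⟨KacMoodyData.epsilon_eq h, KacMoodyData.phi_eq h⟩
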